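/- (Proposition 5.1, lower bound at a single interface in the subcritical regime.) Assume W is continuous and satisfies (H1), (H2) and the normalization of the wells. Let ρ > 0, α ∈ ℝ, let J ⊂ ℝ be a bounded open interval, and set U' := (α−ρ, α+ρ) × J ⊂ ℝ². Let u : U' → ℝ³ be Lipschitz and b : U' → ℝ³ bounded measurable such that either the 3×3 matrix (∂₁u, ∂₂u, b) equals A a.e. on U' ∩ {x₁ > α} and equals B a.e. on U' ∩ {x₁ < α}, or it equals B a.e. on U' ∩ {x₁ > α} and A a.e. on U' ∩ {x₁ < α}. Then for every sequence ε_n → 0⁺ and all pairs of maps u_n ∈ C²(U';ℝ³), b_n ∈ C¹(U';ℝ³) with ∫_{U'} (|u_n − u| + |b_n − b|) dx' → 0, one has liminf_{n→∞} F⁰_{ε_n}(u_n, b_n, U') ≥ K*₀ · ℒ¹(J). -/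

import Mathlib

open MeasureTheory Filter Topology ENNReal NNReal Set

noncomputable section

/-- Vectors in ℝ³. -/
abbrev V3 := Fin 3 → ℝ

/-- 3×3 matrices, represented as the triple of their columns. -/
abbrev M33 := Fin 3 → V3

/-- Euclidean norm on ℝ³. -/
def vnorm (v : V3) : ℝ := Real.sqrt (∑ i, (v i) ^ 2)

/-- Frobenius (Euclidean) norm on 3×3 matrices. -/
def mnorm (ξ : M33) : ℝ := Real.sqrt (∑ j, ∑ i, (ξ j i) ^ 2)

/-- dist(ξ,{A,B}). -/
def mdist (A B ξ : M33) : ℝ := min (mnorm (ξ - A)) (mnorm (ξ - B))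

/-- Spatial points of ℝ³ = ℝ × ℝ × ℝ. -/
abbrev Pt := ℝ × ℝ × ℝ

/-- Directional partial derivative of a map `u : ℝ³ → ℝ³`. -/
def pd (e : Pt) (u : Pt → V3) (x : Pt) : V3 := fderiv ℝ u x e

def e1 : Pt := (1, 0, 0)
def e2 : Pt := (0, 1, 0)
def e3 : Pt := (0, 0, 1)

/-- Rescaled gradient ∇_h u = (∂₁u, ∂₂u, h⁻¹ ∂₃u), as a 3×3 matrix of columns. -/
def gradh (h : ℝ) (u : Pt → V3) (x : Pt) : M33 :=
  ![pd e1 u x, pd e2 u x, h⁻¹ • pd e3 u x]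

/-- Squared rescaled Hessian |∇²_h u|². -/
def hessh (h : ℝ) (u : Pt → V3) (x : Pt) : ℝ :=
  (vnorm (pd e1 (pd e1 u) x)) ^ 2 + (vnorm (pd e2 (pd e2 u) x)) ^ 2
    + (h⁻¹) ^ 4 * (vnorm (pd e3 (pd e3 u) x)) ^ 2
    + 2 * (vnorm (pd e2 (pd e1 u) x)) ^ 2
    + 2 * (h⁻¹) ^ 2 * (vnorm (pd e3 (pd e1 u) x)) ^ 2
    + 2 * (h⁻¹) ^ 2 * (vnorm (pd e3 (pd e2 u) x)) ^ 2

/-- The energy F^h_ε(u, S) = ∫_S (1/ε) W(∇_h u) + ε |∇²_h u|², valued in [0,∞]. -/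
def F (W : M33 → ℝ) (h ε : ℝ) (u : Pt → V3) (S : Set Pt) : ℝ≥0∞ :=
  ∫⁻ x in S, ENNReal.ofReal (ε⁻¹ * W (gradh h u x) + ε * hessh h u x)

/-- Hypothesis (H1): W ≥ 0, {W = 0} = {A, B}, A ≠ B, and A' − B' = 2 a ⊗ ν̄ for
some a ∈ ℝ³ and a unit vector ν̄ ∈ ℝ². -/
def H1 (W : M33 → ℝ) (A B : M33) : Prop :=
  (∀ ξ, 0 ≤ W ξ) ∧ (∀ ξ, W ξ = 0 ↔ ξ = A ∨ ξ = B) ∧ A ≠ B ∧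
    ∃ (a : V3) (ν : ℝ × ℝ), ν.1 ^ 2 + ν.2 ^ 2 = 1 ∧
      A 0 - B 0 = (2 * ν.1) • a ∧ A 1 - B 1 = (2 * ν.2) • a

/-- Hypothesis (H2): p-growth from above and below. -/
def H2 (W : M33 → ℝ) (p : ℝ) : Prop :=
  ∃ C > (0 : ℝ), ∀ ξ, C⁻¹ * (mnorm ξ) ^ p - C ≤ W ξ ∧ W ξ ≤ C * (mnorm ξ) ^ p + C

/-- Hypothesis (H3): non-degeneracy near the wells. -/
def H3 (W : M33 → ℝ) (A B : M33) (p : ℝ) : Prop :=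
  ∃ ϱ > (0 : ℝ), ∃ C > (0 : ℝ), ∀ ξ, mdist A B ξ ≤ ϱ →
    C⁻¹ * (mdist A B ξ) ^ p ≤ W ξ ∧ W ξ ≤ C * (mdist A B ξ) ^ p

/-- Hypothesis (H4): W(ξ₁, 0, ξ₃) ≤ W(ξ). -/
def H4 (W : M33 → ℝ) : Prop := ∀ ξ : M33, W ![ξ 0, 0, ξ 2] ≤ W ξ

/-- Normalization of the wells: A = −B, first column of A is a, second column is 0. -/
def Wells (A B : M33) (a : V3) : Prop := A = -B ∧ A 0 = a ∧ A 1 = 0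

/-- ū₀(t) = |t| a. -/
def ub0 (a : V3) (t : ℝ) : V3 := |t| • a

/-- b̄₀(t) = A₃ for t ≥ 0, −A₃ (= B₃) for t < 0. -/
def bb0 (A3 : V3) (t : ℝ) : V3 := if 0 ≤ t then A3 else -A3

/-- u₀(x) = ū₀(x₁). -/
def u0 (a : V3) (x : Pt) : V3 := ub0 a x.1

/-- b₀(x) = b̄₀(x₁). -/
def b0 (A3 : V3) (x : Pt) : V3 := bb0 A3 x.1

/-- The interval I = (−1/2, 1/2). -/
def II : Set ℝ := Set.Ioo (-(1 / 2 : ℝ)) (1 / 2)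

/-- The unit cube Q = I × I × I. -/
def Q3 : Set Pt := II ×ˢ (II ×ˢ II)

/-- J_ρ = (ρ I) × J × I. -/
def Jrho (J : Set ℝ) (ρ : ℝ) : Set Pt := (Set.Ioo (-(ρ / 2)) (ρ / 2)) ×ˢ (J ×ˢ II)

/-- The rescaled thin domain Ω = ω × I. -/
def Om (ω : Set (ℝ × ℝ)) : Set Pt := {x | (x.1, x.2.1) ∈ ω ∧ x.2.2 ∈ II}

/-- L¹ convergence on a set U. -/
def TendsL1 (U : Set Pt) (f : ℕ → Pt → V3) (g : Pt → V3) : Prop :=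
  Tendsto (fun n => ∫⁻ x in U, ENNReal.ofReal (vnorm (f n x - g x))) atTop (nhds 0)

/-- L^q convergence on a set U. -/
def TendsLp (U : Set Pt) (q : ℝ) (f : ℕ → Pt → V3) (g : Pt → V3) : Prop :=
  Tendsto (fun n => ∫⁻ x in U, ENNReal.ofReal ((vnorm (f n x - g x)) ^ q)) atTop (nhds 0)

/-- The localized asymptotic energy 𝓔_γ(J, ρ). -/
def Egam (W : M33 → ℝ) (a A3 : V3) (γ : ℝ) (J : Set ℝ) (ρ : ℝ) : ℝ≥0∞ :=
  sInf { L : ℝ≥0∞ | ∃ (h ε : ℕ → ℝ) (u : ℕ → Pt → V3),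
    (∀ n, 0 < h n) ∧ (∀ n, 0 < ε n) ∧
    Tendsto h atTop (nhds 0) ∧ Tendsto ε atTop (nhds 0) ∧
    Tendsto (fun n => h n / ε n) atTop (nhds γ) ∧
    (∀ n, ContDiffOn ℝ 2 (u n) (Jrho J ρ)) ∧
    TendsL1 (Jrho J ρ) u (u0 a) ∧
    TendsL1 (Jrho J ρ) (fun n x => (h n)⁻¹ • pd e3 (u n) x) (b0 A3) ∧
    L = Filter.liminf (fun n => F W (h n) (ε n) (u n) (Jrho J ρ)) atTop }

/-- K*_γ = 𝓔_γ(I, 1). -/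
def Kstar (W : M33 → ℝ) (a A3 : V3) (γ : ℝ) : ℝ≥0∞ := Egam W a A3 γ II 1

/-- K*_∞ : the analogue of K*_γ for h/ε → ∞, on the unit cube Q. -/
def KstarInf (W : M33 → ℝ) (a A3 : V3) : ℝ≥0∞ :=
  sInf { L : ℝ≥0∞ | ∃ (h ε : ℕ → ℝ) (u : ℕ → Pt → V3),
    (∀ n, 0 < h n) ∧ (∀ n, 0 < ε n) ∧
    Tendsto h atTop (nhds 0) ∧ Tendsto ε atTop (nhds 0) ∧
    Tendsto (fun n => h n / ε n) atTop atTop ∧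
    (∀ n, ContDiffOn ℝ 2 (u n) Q3) ∧
    TendsL1 Q3 u (u0 a) ∧
    TendsL1 Q3 (fun n x => (h n)⁻¹ • pd e3 (u n) x) (b0 A3) ∧
    L = Filter.liminf (fun n => F W (h n) (ε n) (u n) Q3) atTop }

open Classical in
/-- The phase matrix: B on E, A off E. -/
def Mfun (A B : M33) (E : Set (ℝ × ℝ)) (x' : ℝ × ℝ) : M33 := if x' ∈ E then B else A

/-! ### Two-dimensional objects -/

abbrev Pt2 := ℝ × ℝ

/-- Directional partial derivative of a map `v : ℝ² → ℝ³`. -/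
def qd (e : Pt2) (v : Pt2 → V3) (y : Pt2) : V3 := fderiv ℝ v y e

def f1 : Pt2 := (1, 0)
def f2 : Pt2 := (0, 1)

/-- 𝒲(∇v) = W(∂₁v, 0, ∂₂v). -/
def W2 (W : M33 → ℝ) (v : Pt2 → V3) (y : Pt2) : ℝ := W ![qd f1 v y, 0, qd f2 v y]

/-- Squared 2D Hessian |∇²v|². -/
def hess2d (v : Pt2 → V3) (y : Pt2) : ℝ :=
  (vnorm (qd f1 (qd f1 v) y)) ^ 2 + 2 * (vnorm (qd f2 (qd f1 v) y)) ^ 2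
    + (vnorm (qd f2 (qd f2 v) y)) ^ 2

/-- The rectangle ℓI × γI. -/
def Rect (ℓ γ : ℝ) : Set Pt2 := Set.Ioo (-(ℓ / 2)) (ℓ / 2) ×ˢ Set.Ioo (-(γ / 2)) (γ / 2)

/-- The optimal-profile constant K_γ of the critical regime. -/
def Kgam (W : M33 → ℝ) (a A3 : V3) (γ : ℝ) : ℝ≥0∞ :=
  sInf { L : ℝ≥0∞ | ∃ ℓ > (0 : ℝ), ∃ v : Pt2 → V3,
    ContDiffOn ℝ 2 v (Rect ℓ γ) ∧
    (∃ δ > (0 : ℝ), ∀ y ∈ Rect ℓ γ, ℓ / 2 - δ < y.1 → qd f1 v y = a ∧ qd f2 v y = A3) ∧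
    (∃ δ > (0 : ℝ), ∀ y ∈ Rect ℓ γ, y.1 < -(ℓ / 2) + δ → qd f1 v y = -a ∧ qd f2 v y = -A3) ∧
    L = ENNReal.ofReal γ⁻¹ *
      ∫⁻ y in Rect ℓ γ, ENNReal.ofReal (W2 W v y + hess2d v y) }

/-- The 2D subcritical functional F⁰_ε(u, b, D). -/
def F0 (W : M33 → ℝ) (ε : ℝ) (u b : Pt2 → V3) (D : Set Pt2) : ℝ≥0∞ :=
  ∫⁻ y in D, ENNReal.ofReal (ε⁻¹ * W ![qd f1 u y, qd f2 u y, b y]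
    + ε * ((vnorm (qd f1 (qd f1 u) y)) ^ 2 + 2 * (vnorm (qd f2 (qd f1 u) y)) ^ 2
      + (vnorm (qd f2 (qd f2 u) y)) ^ 2
      + 2 * (vnorm (qd f1 b y)) ^ 2 + 2 * (vnorm (qd f2 b y)) ^ 2))

/-- K*₀: the subcritical cell constant. -/
def Kstar0 (W : M33 → ℝ) (a A3 : V3) : ℝ≥0∞ :=
  sInf { L : ℝ≥0∞ | ∃ (ε : ℕ → ℝ) (u b : ℕ → Pt2 → V3),
    (∀ n, 0 < ε n) ∧ Tendsto ε atTop (nhds 0) ∧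
    (∀ n, ContDiffOn ℝ 2 (u n) (II ×ˢ II)) ∧ (∀ n, ContDiffOn ℝ 1 (b n) (II ×ˢ II)) ∧
    Tendsto (fun n => ∫⁻ y in II ×ˢ II,
      ENNReal.ofReal (vnorm (u n y - ub0 a y.1) + vnorm (b n y - bb0 A3 y.1)))
      atTop (nhds 0) ∧
    L = Filter.liminf (fun n => F0 W (ε n) (u n) (b n) (II ×ˢ II)) atTop }

/-- K₀: the subcritical optimal-profile constant. -/
def K0 (W : M33 → ℝ) (a A3 : V3) : ℝ≥0∞ :=
  sInf { L : ℝ≥0∞ | ∃ ℓ > (0 : ℝ), ∃ φ1 φ2 : ℝ → V3,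
    ContDiffOn ℝ 1 φ1 (Set.Icc (-ℓ) ℓ) ∧ ContDiffOn ℝ 1 φ2 (Set.Icc (-ℓ) ℓ) ∧
    φ1 ℓ = a ∧ φ2 ℓ = A3 ∧ φ1 (-ℓ) = -a ∧ φ2 (-ℓ) = -A3 ∧
    L = ∫⁻ t in Set.Ioo (-ℓ) ℓ, ENNReal.ofReal (W ![φ1 t, 0, φ2 t]
      + (vnorm (derivWithin φ1 (Set.Icc (-ℓ) ℓ) t)) ^ 2
      + 2 * (vnorm (derivWithin φ2 (Set.Icc (-ℓ) ℓ) t)) ^ 2) }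

/-- K_∞ in the case λ = 0. -/
def KinfZero (W : M33 → ℝ) (a : V3) : ℝ≥0∞ :=
  sInf { L : ℝ≥0∞ | ∃ ℓ > (0 : ℝ), ∃ v : Pt2 → V3,
    ContDiff ℝ 2 v ∧ (∀ y : Pt2, v (y.1, y.2 + 1) = v y) ∧
    (∃ δ > (0 : ℝ), ∀ y : Pt2, |y.1 - 1 / 2| < δ → qd f1 v y = a ∧ qd f2 v y = 0) ∧
    (∃ δ > (0 : ℝ), ∀ y : Pt2, |y.1 + 1 / 2| < δ → qd f1 v y = -a ∧ qd f2 v y = 0) ∧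
    L = ∫⁻ y in II ×ˢ II, ENNReal.ofReal (ℓ * W2 W v y + ℓ⁻¹ * hess2d v y) }

/-- The unit normal ν_λ = (1+λ²)^{-1/2} (1, λ). -/
def nuv (lam : ℝ) : Pt2 := (1 / Real.sqrt (1 + lam ^ 2), lam / Real.sqrt (1 + lam ^ 2))

/-- The orthogonal direction ν_λ^⊥ = (1+λ²)^{-1/2} (−λ, 1). -/
def nupv (lam : ℝ) : Pt2 := (-lam / Real.sqrt (1 + lam ^ 2), 1 / Real.sqrt (1 + lam ^ 2))

/-- Dot product on ℝ². -/
def dotp (w y : Pt2) : ℝ := w.1 * y.1 + w.2 * y.2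

/-- The unit square Q'_λ centered at 0 with two sides orthogonal to ν_λ. -/
def Qlam (lam : ℝ) : Set Pt2 := {y | |dotp (nuv lam) y| < 1 / 2 ∧ |dotp (nupv lam) y| < 1 / 2}

/-- K_∞ for general λ. -/
def KinfL (W : M33 → ℝ) (a : V3) (lam : ℝ) : ℝ≥0∞ :=
  ENNReal.ofReal (Real.sqrt (1 + lam ^ 2)) *
    sInf { L : ℝ≥0∞ | ∃ ℓ > (0 : ℝ), ∃ v : Pt2 → V3,
      ContDiff ℝ 2 v ∧ (∀ y : Pt2, v (y + nupv lam) = v y) ∧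
      (∃ δ > (0 : ℝ), ∀ y : Pt2, |dotp (nuv lam) y - 1 / 2| < δ →
        qd f1 v y = a ∧ qd f2 v y = lam • a) ∧
      (∃ δ > (0 : ℝ), ∀ y : Pt2, |dotp (nuv lam) y + 1 / 2| < δ →
        qd f1 v y = -a ∧ qd f2 v y = -(lam • a)) ∧
      L = ∫⁻ y in Qlam lam, ENNReal.ofReal (ℓ * W2 W v y + ℓ⁻¹ * hess2d v y) }

/-- Number of interfaces strictly below t. -/
def cnt (m : ℕ) (α : Fin m → ℝ) (t : ℝ) : ℕ := (Finset.univ.filter (fun i => α i < t)).card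

end
/-! ### The Euclidean norm and partial derivatives under affine rescalings -/

lemma vnorm_nonneg (v : V3) : 0 ≤ vnorm v := Real.sqrt_nonneg _

lemma vnorm_smul (k : ℝ) (v : V3) : vnorm (k • v) = |k| * vnorm v := by
  have h : ∑ i, ((k • v) i) ^ 2 = k ^ 2 * ∑ i, (v i) ^ 2 := by
    simp only [Pi.smul_apply, smul_eq_mul, mul_pow, Finset.mul_sum]
  rw [vnorm, h, Real.sqrt_mul (sq_nonneg k), Real.sqrt_sq_eq_abs, vnorm]

lemma qd_const_smul (e : Pt2) (k : ℝ) (g : Pt2 → V3) :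
    qd e (fun y => k • g y) = fun y => k • qd e g y := by
  funext y
  have h := congrFun (fderiv_const_smul_field (𝕜 := ℝ) (f := g) k) y
  change fderiv ℝ (k • g) y e = _
  rw [h]
  rfl

lemma qd_comp_affine (e : Pt2) (r : ℝ) (x₀ : Pt2) (g : Pt2 → V3) :
    qd e (fun y => g (r • y + x₀)) = fun y => r • qd e g (r • y + x₀) := by
  funext y
  have h := fderiv_comp_smul (𝕜 := ℝ) (f := fun z => g (z + x₀)) (x := y) r
  simp only [qd]
  rw [h, fderiv_comp_add_right]
  rfl

lemma qd_sub_const (e : Pt2) (g : Pt2 → V3) (c₀ : V3) :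
    qd e (fun y => g y - c₀) = qd e g := by
  funext y
  simp only [qd, fderiv_sub_const]

lemma qd_rescale (e : Pt2) {r : ℝ} (hr : r ≠ 0) (x₀ : Pt2) (c₀ : V3) (g : Pt2 → V3) :
    qd e (fun y => r⁻¹ • (g (r • y + x₀) - c₀)) = fun y => qd e g (r • y + x₀) := by
  rw [qd_const_smul e r⁻¹ (fun y => g (r • y + x₀) - c₀), qd_sub_const, qd_comp_affine]
  funext y
  simp only [smul_smul, inv_mul_cancel₀ hr, one_smul]

/-- Affine change of variables in the plane; the integrand need not be measurable. -/
lemma setLIntegral_comp_affine {r : ℝ} (hr : r ≠ 0) (x₀ : Pt2) (S : Set Pt2)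
    (G : Pt2 → ℝ≥0∞) :
    ∫⁻ y in (fun y : Pt2 => r • y + x₀) ⁻¹' S, G (r • y + x₀)
      = ENNReal.ofReal ((r ^ 2)⁻¹) * ∫⁻ x in S, G x := by
  have hemb : MeasurableEmbedding (fun y : Pt2 => r • y + x₀) :=
    ((Homeomorph.smulOfNeZero r hr).trans (Homeomorph.addRight x₀)).measurableEmbedding
  have hmap : Measure.map (fun y : Pt2 => r • y + x₀) volume
      = ENNReal.ofReal ((r ^ 2)⁻¹) • (volume : Measure Pt2) := by
    have h1 : (fun y : Pt2 => r • y + x₀) = (fun y => y + x₀) ∘ (fun y => r • y) := rfl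
    rw [h1, ← Measure.map_map (measurable_add_const x₀) (measurable_const_smul r),
      Measure.map_addHaar_smul volume hr, Measure.map_smul, map_add_right_eq_self]
    congr 2
    rw [abs_of_nonneg (by simp; positivity)]
    simp
  rw [← hemb.lintegral_map, ← hemb.restrict_map, hmap, Measure.restrict_smul,
    lintegral_smul_measure, smul_eq_mul]

lemma F0_rescale (W : M33 → ℝ) {ε r : ℝ} (hr : r ≠ 0) (u b : Pt2 → V3) (x₀ : Pt2)
    (c₀ : V3) (S : Set Pt2) :
    F0 W (ε / |r|) (fun y => r⁻¹ • (u (r • y + x₀) - c₀)) (fun y => b (r • y + x₀))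
      ((fun y : Pt2 => r • y + x₀) ⁻¹' S) = ENNReal.ofReal |r|⁻¹ * F0 W ε u b S := by
  have hr' : 0 < |r| := abs_pos.2 hr
  have hc : |r|⁻¹ = |r| * (r ^ 2)⁻¹ := by
    rw [← sq_abs]; field_simp
  rw [F0, F0, hc, ENNReal.ofReal_mul hr'.le, mul_assoc,
    ← setLIntegral_comp_affine hr x₀ S, ← lintegral_const_mul' _ _ ENNReal.ofReal_ne_top]
  congr 1
  funext y
  rw [← ENNReal.ofReal_mul hr'.le]
  simp only [qd_rescale _ hr, qd_comp_affine, vnorm_smul, mul_pow]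
  congr 1
  field_simp

/-! ### The cell problem on a single rescaled square -/

lemma Kstar0_mul_le_liminf_F0 (W : M33 → ℝ) (a A3 : V3) {r : ℝ} (hr : r ≠ 0) (x₀ : Pt2)
    (c₀ : V3) {S : Set Pt2}
    (hSpre : (fun y : Pt2 => r • y + x₀) ⁻¹' S = II ×ˢ II) {u b : Pt2 → V3}
    (hub : ∀ᵐ x ∂(volume.restrict S), u x = c₀ + r • ub0 a (r⁻¹ * (x.1 - x₀.1)) ∧
      b x = bb0 A3 (r⁻¹ * (x.1 - x₀.1)))
    {ε : ℕ → ℝ} (hε : ∀ n, 0 < ε n) (hε0 : Tendsto ε atTop (nhds 0))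
    {un bn : ℕ → Pt2 → V3}
    (hun : ∀ n, ContDiffOn ℝ 2 (un n) S) (hbn : ∀ n, ContDiffOn ℝ 1 (bn n) S)
    (hconv : Tendsto (fun n => ∫⁻ y in S,
      ENNReal.ofReal (vnorm (un n y - u y) + vnorm (bn n y - b y))) atTop (nhds 0)) :
    Kstar0 W a A3 * ENNReal.ofReal |r| ≤
      Filter.liminf (fun n => F0 W (ε n) (un n) (bn n) S) atTop := by
  have hr' : 0 < |r| := abs_pos.2 hr
  have hmaps : MapsTo (fun y : Pt2 => r • y + x₀) (II ×ˢ II) S := by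
    rw [← hSpre]; exact mapsTo_preimage _ _
  have haff : ∀ m : WithTop ℕ∞, ContDiffOn ℝ m (fun y : Pt2 => r • y + x₀) (II ×ˢ II) :=
    fun m => ((contDiff_const_smul r).add contDiff_const).contDiffOn
  have hK : Kstar0 W a A3 ≤ Filter.liminf (fun n => F0 W (ε n / |r|)
      (fun y => r⁻¹ • (un n (r • y + x₀) - c₀)) (fun y => bn n (r • y + x₀)) (II ×ˢ II))
      atTop := by
    refine sInf_le ⟨fun n => ε n / |r|, fun n y => r⁻¹ • (un n (r • y + x₀) - c₀),
      fun n y => bn n (r • y + x₀), fun n => div_pos (hε n) hr', ?_, ?_, ?_, ?_, rfl⟩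
    · simpa using hε0.div_const |r|
    · intro n
      exact (((hun n).comp (haff 2) hmaps).sub contDiffOn_const).const_smul r⁻¹
    · intro n
      exact (hbn n).comp (haff 1) hmaps
    · have hbound : ∀ n, ∫⁻ y in II ×ˢ II, ENNReal.ofReal
          (vnorm (r⁻¹ • (un n (r • y + x₀) - c₀) - ub0 a y.1)
            + vnorm (bn n (r • y + x₀) - bb0 A3 y.1)) ≤
          (ENNReal.ofReal ((r ^ 2)⁻¹) * ENNReal.ofReal (|r|⁻¹ + 1)) * ∫⁻ x in S,
            ENNReal.ofReal (vnorm (un n x - u x) + vnorm (bn n x - b x)) := by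
        intro n
        have h := setLIntegral_comp_affine hr x₀ S (fun x => ENNReal.ofReal
          (vnorm (r⁻¹ • (un n x - c₀) - ub0 a (r⁻¹ * (x.1 - x₀.1)))
            + vnorm (bn n x - bb0 A3 (r⁻¹ * (x.1 - x₀.1)))))
        simp only [Prod.fst_add, Prod.smul_fst, smul_eq_mul, add_sub_cancel_right,
          inv_mul_cancel_left₀ hr, hSpre] at h
        rw [h, mul_assoc]
        refine mul_le_mul' le_rfl ?_
        rw [← lintegral_const_mul' _ _ ENNReal.ofReal_ne_top]
        refine lintegral_mono_ae ?_
        filter_upwards [hub] with x hx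
        rw [← ENNReal.ofReal_mul (by positivity), hx.1, hx.2]
        refine ENNReal.ofReal_le_ofReal ?_
        have heq : r⁻¹ • (un n x - c₀) - ub0 a (r⁻¹ * (x.1 - x₀.1))
            = r⁻¹ • (un n x - (c₀ + r • ub0 a (r⁻¹ * (x.1 - x₀.1)))) := by
          rw [← sub_sub, smul_sub _ (un n x - c₀), smul_smul, inv_mul_cancel₀ hr, one_smul]
        rw [heq, vnorm_smul, abs_inv]
        have h1 := vnorm_nonneg (un n x - (c₀ + r • ub0 a (r⁻¹ * (x.1 - x₀.1))))
        have h2 := vnorm_nonneg (bn n x - bb0 A3 (r⁻¹ * (x.1 - x₀.1)))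
        have h3 : 0 ≤ |r|⁻¹ := by positivity
        nlinarith [mul_nonneg h3 h2]
      refine tendsto_of_tendsto_of_tendsto_of_le_of_le tendsto_const_nhds ?_
        (fun _ => bot_le) hbound
      have h := ENNReal.Tendsto.const_mul (a := ENNReal.ofReal ((r ^ 2)⁻¹) *
        ENNReal.ofReal (|r|⁻¹ + 1)) hconv
        (Or.inr (ENNReal.mul_ne_top ENNReal.ofReal_ne_top ENNReal.ofReal_ne_top))
      simpa using h
  have hscale : ∀ n, F0 W (ε n / |r|)
      (fun y => r⁻¹ • (un n (r • y + x₀) - c₀)) (fun y => bn n (r • y + x₀)) (II ×ˢ II)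
      = ENNReal.ofReal |r|⁻¹ * F0 W (ε n) (un n) (bn n) S := fun n => by
    rw [← hSpre, F0_rescale W hr]
  simp only [hscale] at hK
  rw [ENNReal.liminf_const_mul_of_ne_top ENNReal.ofReal_ne_top] at hK
  calc Kstar0 W a A3 * ENNReal.ofReal |r|
      ≤ (ENNReal.ofReal |r|⁻¹ * Filter.liminf (fun n => F0 W (ε n) (un n) (bn n) S) atTop)
        * ENNReal.ofReal |r| := by gcongr
    _ = _ := by
      rw [mul_right_comm, ← ENNReal.ofReal_mul (by positivity), inv_mul_cancel₀ hr'.ne',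
        ENNReal.ofReal_one, one_mul]

lemma sum_liminf_le_liminf_sum {ι : Type*} (s : Finset ι) (f : ι → ℕ → ℝ≥0∞) :
    ∑ i ∈ s, Filter.liminf (f i) atTop ≤ Filter.liminf (fun n => ∑ i ∈ s, f i n) atTop := by
  simp only [liminf_eq_iSup_iInf_of_nat]
  rw [ENNReal.finsetSum_iSup_of_monotone fun i m n hmn =>
    biInf_mono fun _ hj => hmn.trans hj]
  exact iSup_mono fun n => le_iInf₂ fun j hj =>
    Finset.sum_le_sum fun i _ => iInf₂_le j hj

/-! ### Lipschitz maps on rectangles with constant gradient -/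

lemma eq_of_ae_hasFDerivAt_zero_snd {E : Type*} [NormedAddCommGroup E] [NormedSpace ℝ E]
    {w : ℝ × ℝ → E} {K : ℝ≥0} {l r c d : ℝ}
    (hw : LipschitzOnWith K w (Ioo l r ×ˢ Ioo c d))
    (h0 : ∀ᵐ z : ℝ × ℝ, z ∈ Ioo l r ×ˢ Ioo c d →
      HasFDerivAt w (0 : ℝ × ℝ →L[ℝ] E) z)
    {x y₁ y₂ : ℝ} (hx : x ∈ Ioo l r) (hy₁ : y₁ ∈ Ioo c d) (hy₂ : y₂ ∈ Ioo c d) :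
    w (x, y₁) = w (x, y₂) := by
  have hsub : uIcc y₁ y₂ ⊆ Ioo c d := (ordConnected_Ioo).uIcc_subset hy₁ hy₂
  have hae : (fun t => w (t, y₁)) =ᵐ[volume.restrict (Ioo l r)] fun t => w (t, y₂) := by
    rw [Filter.EventuallyEq, ae_restrict_iff' measurableSet_Ioo]
    rw [Measure.volume_eq_prod] at h0
    filter_upwards [Measure.ae_ae_of_ae_prod h0] with t ht htm
    have hlip : LipschitzOnWith K (fun y => w (t, y)) (uIcc y₁ y₂) := by
      intro p hp q hq
      refine (hw ⟨htm, hsub hp⟩ ⟨htm, hsub hq⟩).trans ?_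
      simp [Prod.edist_eq]
    obtain ⟨C, hC⟩ := hlip.absolutelyContinuousOnInterval.const_of_ae_hasDerivAt_zero (by
      filter_upwards [ht] with y hy hym
      exact (hy ⟨htm, hsub hym⟩).comp_hasDerivAt y
        ((hasDerivAt_const y t).prodMk (hasDerivAt_id y)))
    rw [hC _ left_mem_uIcc, hC _ right_mem_uIcc]
  have hcont : ∀ y ∈ Ioo c d, ContinuousOn (fun t => w (t, y)) (Ioo l r) := fun y hy =>
    hw.continuousOn.comp (by fun_prop) fun t ht => ⟨ht, hy⟩
  exact Measure.eqOn_open_of_ae_eq hae isOpen_Ioo (hcont _ hy₁) (hcont _ hy₂) hx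

lemma eq_of_ae_hasFDerivAt_zero {E : Type*} [NormedAddCommGroup E] [NormedSpace ℝ E]
    {w : ℝ × ℝ → E} {K : ℝ≥0} {l r c d : ℝ}
    (hw : LipschitzOnWith K w (Ioo l r ×ˢ Ioo c d))
    (h0 : ∀ᵐ z : ℝ × ℝ, z ∈ Ioo l r ×ˢ Ioo c d →
      HasFDerivAt w (0 : ℝ × ℝ →L[ℝ] E) z)
    {p q : ℝ × ℝ} (hp : p ∈ Ioo l r ×ˢ Ioo c d) (hq : q ∈ Ioo l r ×ˢ Ioo c d) :
    w p = w q := by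
  have h1 : w (p.1, p.2) = w (p.1, q.2) := eq_of_ae_hasFDerivAt_zero_snd hw h0 hp.1 hp.2 hq.2
  have hw' : LipschitzOnWith K (w ∘ Prod.swap) (Ioo c d ×ˢ Ioo l r) := by
    intro x hx y hy
    refine (hw ⟨hx.2, hx.1⟩ ⟨hy.2, hy.1⟩).trans ?_
    simp [Prod.edist_eq, max_comm]
  have h0' : ∀ᵐ z : ℝ × ℝ, z ∈ Ioo c d ×ˢ Ioo l r →
      HasFDerivAt (w ∘ Prod.swap) (0 : ℝ × ℝ →L[ℝ] E) z := by
    have hsw : MeasurePreserving (Prod.swap : ℝ × ℝ → ℝ × ℝ) volume volume :=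
      Measure.measurePreserving_swap
    filter_upwards [hsw.quasiMeasurePreserving.ae h0] with z hz hzm
    have := (hz ⟨hzm.2, hzm.1⟩).comp z
      (ContinuousLinearEquiv.prodComm ℝ ℝ ℝ).hasFDerivAt
    simpa using this
  have h2 : (w ∘ Prod.swap) (q.2, p.1) = (w ∘ Prod.swap) (q.2, q.1) :=
    eq_of_ae_hasFDerivAt_zero_snd hw' h0' hq.2 hp.1 hq.1
  exact h1.trans h2

lemma eq_affine_of_ae_qd_eq {u : Pt2 → V3} {K : ℝ≥0} {l r c d : ℝ} {m : V3}
    (hu : LipschitzOnWith K u (Ioo l r ×ˢ Ioo c d))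
    (h : ∀ᵐ z : Pt2, z ∈ Ioo l r ×ˢ Ioo c d → qd f1 u z = m ∧ qd f2 u z = 0)
    {p q : Pt2} (hp : p ∈ Ioo l r ×ˢ Ioo c d) (hq : q ∈ Ioo l r ×ˢ Ioo c d) :
    u p - p.1 • m = u q - q.1 • m := by
  let L : Pt2 →L[ℝ] V3 := (ContinuousLinearMap.fst ℝ ℝ ℝ).smulRight m
  have hLip : LipschitzOnWith (K + ‖L‖₊) (fun z => u z - L z) (Ioo l r ×ˢ Ioo c d) :=
    hu.sub L.lipschitz.lipschitzOnWith
  have h0 : ∀ᵐ z : Pt2, z ∈ Ioo l r ×ˢ Ioo c d →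
      HasFDerivAt (fun z => u z - L z) (0 : Pt2 →L[ℝ] V3) z := by
    filter_upwards [h, hu.ae_differentiableWithinAt_of_mem (μ := volume)] with z hz hd hzm
    have hdiff : DifferentiableAt ℝ u z :=
      (hd hzm).differentiableAt ((isOpen_Ioo.prod isOpen_Ioo).mem_nhds hzm)
    have heq : fderiv ℝ u z = L := by
      obtain ⟨h1, h2⟩ := hz hzm
      refine ContinuousLinearMap.ext fun v => ?_
      have hv : v = v.1 • f1 + v.2 • f2 := by ext <;> simp [f1, f2]
      simp only [qd] at h1 h2
      rw [hv, map_add, map_smul, map_smul, h1, h2]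
      simp [L, f1, f2]
    have := hdiff.hasFDerivAt.sub L.hasFDerivAt
    rw [heq, sub_self] at this
    exact this
  exact eq_of_ae_hasFDerivAt_zero hLip h0 hp hq

/-- A Lipschitz map whose gradient is `m ⊗ e₁` to the right of the line `x₁ = α` and
`-m ⊗ e₁` to its left equals `|x₁ - α| m` up to a constant. -/
lemma eq_add_abs_smul_of_ae_qd_eq {u : Pt2 → V3} {K : ℝ≥0} {α ρ c d : ℝ} {m : V3}
    (hρ : 0 < ρ) (hcd : c < d)
    (hu : LipschitzOnWith K u (Ioo (α - ρ) (α + ρ) ×ˢ Ioo c d))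
    (h : ∀ᵐ z : Pt2, z ∈ Ioo (α - ρ) (α + ρ) ×ˢ Ioo c d →
      (α < z.1 → qd f1 u z = m ∧ qd f2 u z = 0) ∧
      (z.1 < α → qd f1 u z = -m ∧ qd f2 u z = 0)) :
    ∃ c₀ : V3, ∀ z ∈ Ioo (α - ρ) (α + ρ) ×ˢ Ioo c d, z.1 ≠ α →
      u z = c₀ + |z.1 - α| • m := by
  have hy₀ : (c + d) / 2 ∈ Ioo c d := ⟨by linarith, by linarith⟩
  have hα : α ∈ Ioo (α - ρ) (α + ρ) := ⟨by linarith, by linarith⟩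
  have hside : ∀ (l r : ℝ) (m' : V3), l < r → Ioo l r ⊆ Ioo (α - ρ) (α + ρ) →
      α ∈ Icc l r →
      (∀ᵐ z : Pt2, z ∈ Ioo l r ×ˢ Ioo c d → qd f1 u z = m' ∧ qd f2 u z = 0) →
      ∀ z ∈ Ioo l r ×ˢ Ioo c d, u z = u (α, (c + d) / 2) + (z.1 - α) • m' := by
    intro l r m' hlr hsub hαm hq z hz
    have huV := hu.mono (prod_mono hsub (Subset.refl (Ioo c d)))
    have hE : EqOn (fun t => u (t, (c + d) / 2)) (fun t => u z + (t - z.1) • m')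
        (Ioo l r) := by
      intro t ht
      have := eq_affine_of_ae_qd_eq huV hq (p := (t, (c + d) / 2)) ⟨ht, hy₀⟩ hz
      simp only [sub_smul]
      rw [sub_eq_sub_iff_add_eq_add] at this
      rw [add_sub, eq_sub_iff_add_eq]
      exact this
    have hE' : EqOn (fun t => u (t, (c + d) / 2)) (fun t => u z + (t - z.1) • m')
        (insert α (Ioo l r)) := by
      refine hE.of_subset_closure ?_ (by fun_prop) (subset_insert _ _) ?_
      · refine hu.continuousOn.comp (by fun_prop) fun t ht => ⟨?_, hy₀⟩
        rcases ht with rfl | ht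
        · exact hα
        · exact hsub ht
      · rw [closure_Ioo hlr.ne]
        exact insert_subset hαm Ioo_subset_Icc_self
    have := hE' (mem_insert _ _)
    simp only at this
    rw [this, add_assoc, ← add_smul]
    simp
  have hR := hside α (α + ρ) m (by linarith) (Ioo_subset_Ioo_left (by linarith))
    ⟨le_rfl, by linarith⟩ (by
      filter_upwards [h] with z hz hzm
      exact (hz ⟨⟨by linarith [hzm.1.1], hzm.1.2⟩, hzm.2⟩).1 hzm.1.1)
  have hL := hside (α - ρ) α (-m) (by linarith) (Ioo_subset_Ioo_right (by linarith))
    ⟨by linarith, le_rfl⟩ (by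
      filter_upwards [h] with z hz hzm
      exact (hz ⟨⟨hzm.1.1, by linarith [hzm.1.2]⟩, hzm.2⟩).2 hzm.1.2)
  refine ⟨u (α, (c + d) / 2), fun z hz hne => ?_⟩
  rcases lt_or_gt_of_ne hne with hlt | hgt
  · rw [hL z ⟨⟨hz.1.1, hlt⟩, hz.2⟩, abs_of_neg (by linarith), smul_neg, neg_smul]
  · rw [hR z ⟨⟨hgt, hz.1.2⟩, hz.2⟩, abs_of_pos (by linarith)]

/-! ### Tiling the interface -/

lemma mul_add_mem_Ioo_iff_mem_II {r : ℝ} (hr : r ≠ 0) (e y : ℝ) :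
    r * y + e ∈ Ioo (e - |r| / 2) (e + |r| / 2) ↔ y ∈ II := by
  have hr' : 0 < |r| := abs_pos.2 hr
  have h1 : r * y + e ∈ Ioo (e - |r| / 2) (e + |r| / 2) ↔ |r * y| < |r| / 2 := by
    rw [abs_lt, mem_Ioo]
    constructor <;> rintro ⟨h, h'⟩ <;> constructor <;> linarith
  have h2 : y ∈ II ↔ |y| < 1 / 2 := by rw [abs_lt]; rfl
  rw [h1, h2, abs_mul]
  constructor <;> intro h <;> nlinarith

lemma preimage_affine_square {r : ℝ} (hr : r ≠ 0) (x₀ : Pt2) :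
    (fun y : Pt2 => r • y + x₀) ⁻¹'
      (Ioo (x₀.1 - |r| / 2) (x₀.1 + |r| / 2) ×ˢ Ioo (x₀.2 - |r| / 2) (x₀.2 + |r| / 2))
      = II ×ˢ II := by
  ext y
  exact and_congr (mul_add_mem_Ioo_iff_mem_II hr x₀.1 y.1) (mul_add_mem_Ioo_iff_mem_II hr x₀.2 y.2)

lemma ae_fst_ne (α : ℝ) : ∀ᵐ z : Pt2, z.1 ≠ α := by
  rw [Measure.volume_eq_prod]
  exact Measure.quasiMeasurePreserving_fst.ae (Measure.ae_ne volume α)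

lemma disjoint_subintervals {c t : ℝ} (ht : 0 < t) {i j : ℕ} (hij : i ≠ j) :
    Disjoint (Ioo (c + (i + 1 / 2) * t - t / 2) (c + (i + 1 / 2) * t + t / 2))
      (Ioo (c + (j + 1 / 2) * t - t / 2) (c + (j + 1 / 2) * t + t / 2)) := by
  wlog h : i < j generalizing i j
  · exact (this hij.symm (lt_of_le_of_ne (not_lt.1 h) hij.symm)).symm
  rw [Set.disjoint_left]
  intro x hx hx'
  have h1 : (i : ℝ) + 1 ≤ j := by exact_mod_cast h
  nlinarith [hx.2, hx'.1]

lemma subinterval_subset {c d : ℝ} {N i : ℕ} {t : ℝ} (ht : 0 < t) (hNt : N * t = d - c)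
    (hi : i < N) :
    Ioo (c + (i + 1 / 2) * t - t / 2) (c + (i + 1 / 2) * t + t / 2) ⊆ Ioo c d := by
  have h1 : (i : ℝ) + 1 ≤ N := by exact_mod_cast hi
  have h0 : (0 : ℝ) ≤ i := Nat.cast_nonneg i
  refine Ioo_subset_Ioo ?_ ?_ <;> nlinarith

lemma smul_inv_abs_smul {s : ℝ} (hs : s = 1 ∨ s = -1) {t : ℝ} (ht : 0 < t) (x : ℝ) (a : V3) :
    (s * t) • ub0 a ((s * t)⁻¹ * x) = |x| • (s • a) := by
  have hst : |s * t| = t := by rcases hs with rfl | rfl <;> simp [abs_of_pos ht]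
  rw [ub0, abs_mul, abs_inv, hst, smul_smul, smul_smul]
  congr 1
  field_simp

lemma bb0_inv_mul {s : ℝ} (hs : s = 1 ∨ s = -1) {t : ℝ} (ht : 0 < t) {x : ℝ} (hx : x ≠ 0)
    (A3 : V3) : bb0 A3 ((s * t)⁻¹ * x) = if 0 < x then s • A3 else -(s • A3) := by
  have ht' : 0 < t⁻¹ := inv_pos.2 ht
  rcases lt_or_gt_of_ne hx with h | h <;> rcases hs with rfl | rfl
  · simp [bb0, h.not_gt, not_le.2 (mul_neg_of_pos_of_neg ht' h)]
  · have : 0 ≤ (-1 * t)⁻¹ * x := by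
      rw [neg_one_mul, inv_neg]; nlinarith
    rw [bb0, if_pos this, if_neg h.not_gt, neg_one_smul, neg_neg]
  · simp [bb0, h, (mul_pos ht' h).le]
  · have : ¬ 0 ≤ (-1 * t)⁻¹ * x := by
      rw [neg_one_mul, inv_neg]; nlinarith [mul_pos ht' h]
    rw [bb0, if_neg this, if_pos h, neg_one_smul]

/-- Proposition 5.1, lower bound at a single interface,
subcritical regime. -/
theorem statement12 (p : ℝ) (hp : 2 ≤ p) (A B : M33) (W : M33 → ℝ) (a : V3)
    (hWc : Continuous W) (h1 : H1 W A B) (h2 : H2 W p)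
    (hwells : Wells A B a)
    (ρ αi : ℝ) (hρ : 0 < ρ) (c d : ℝ) (hcd : c < d)
    (U' : Set Pt2) (hU' : U' = Set.Ioo (αi - ρ) (αi + ρ) ×ˢ Set.Ioo c d)
    (u b : Pt2 → V3) (K : NNReal) (hu : LipschitzOnWith K u U')
    (hbm : Measurable b) (hbbd : ∃ M : ℝ, ∀ y ∈ U', vnorm (b y) ≤ M)
    (hjump : ∃ M N : M33, ((M = A ∧ N = B) ∨ (M = B ∧ N = A)) ∧
      ∀ᵐ y ∂(volume.restrict U'),
        (αi < y.1 → qd f1 u y = M 0 ∧ qd f2 u y = M 1 ∧ b y = M 2) ∧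
        (y.1 < αi → qd f1 u y = N 0 ∧ qd f2 u y = N 1 ∧ b y = N 2))
    (ε : ℕ → ℝ) (hε : ∀ n, 0 < ε n) (hε0 : Tendsto ε atTop (nhds 0))
    (un bn : ℕ → Pt2 → V3)
    (hun : ∀ n, ContDiffOn ℝ 2 (un n) U') (hbn : ∀ n, ContDiffOn ℝ 1 (bn n) U')
    (hconv : Tendsto (fun n => ∫⁻ y in U',
      ENNReal.ofReal (vnorm (un n y - u y) + vnorm (bn n y - b y))) atTop (nhds 0)) :
    Kstar0 W a (A 2) * volume (Set.Ioo c d) ≤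
      Filter.liminf (fun n => F0 W (ε n) (un n) (bn n) U') atTop := by
  obtain ⟨hAB, hA0, hA1⟩ := hwells
  subst hU'
  have hBA : B = -A := by rw [hAB, neg_neg]
  obtain ⟨s, hs, hub⟩ : ∃ s : ℝ, (s = 1 ∨ s = -1) ∧
      ∀ᵐ y : Pt2, y ∈ Ioo (αi - ρ) (αi + ρ) ×ˢ Ioo c d →
        (αi < y.1 → qd f1 u y = s • a ∧ qd f2 u y = 0 ∧ b y = s • A 2) ∧
        (y.1 < αi → qd f1 u y = -(s • a) ∧ qd f2 u y = 0 ∧ b y = -(s • A 2)) := by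
    obtain ⟨M, N, hMN, hae⟩ := hjump
    rw [ae_restrict_iff' (measurableSet_Ioo.prod measurableSet_Ioo)] at hae
    rcases hMN with ⟨rfl, rfl⟩ | ⟨rfl, rfl⟩
    · exact ⟨1, Or.inl rfl, by simpa [hBA, hA0, hA1] using hae⟩
    · exact ⟨-1, Or.inr rfl, by simpa [hBA, hA0, hA1] using hae⟩
  obtain ⟨c₀, hc₀⟩ := eq_add_abs_smul_of_ae_qd_eq hρ hcd hu (m := s • a) (by
    filter_upwards [hub] with z hz hzm
    exact ⟨fun h => ⟨((hz hzm).1 h).1, ((hz hzm).1 h).2.1⟩,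
      fun h => ⟨((hz hzm).2 h).1, ((hz hzm).2 h).2.1⟩⟩)
  obtain ⟨N, hN⟩ := exists_nat_gt ((d - c) / (2 * ρ))
  have hN0 : (0 : ℝ) < N := lt_of_le_of_lt (by have := sub_pos.2 hcd; positivity) hN
  obtain ⟨t, htdef⟩ : ∃ t : ℝ, t = (d - c) / N := ⟨_, rfl⟩
  have ht : 0 < t := by rw [htdef]; exact div_pos (sub_pos.2 hcd) hN0
  have hNt : N * t = d - c := by rw [htdef]; field_simp
  have htρ : t < 2 * ρ := by
    rw [div_lt_iff₀ (by positivity)] at hN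
    rw [htdef, div_lt_iff₀ hN0]; linarith
  have hst : |s * t| = t := by rcases hs with rfl | rfl <;> simp [abs_of_pos ht]
  have hr : s * t ≠ 0 := by rw [← abs_pos, hst]; exact ht
  let S : ℕ → Set Pt2 := fun i => Ioo (αi - t / 2) (αi + t / 2) ×ˢ
    Ioo (c + (i + 1 / 2) * t - t / 2) (c + (i + 1 / 2) * t + t / 2)
  have hSm : ∀ i, MeasurableSet (S i) := fun i => measurableSet_Ioo.prod measurableSet_Ioo
  have hSU : ∀ i ∈ Finset.range N, S i ⊆ Ioo (αi - ρ) (αi + ρ) ×ˢ Ioo c d := fun i hi =>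
    prod_mono (Ioo_subset_Ioo (by linarith) (by linarith))
      (subinterval_subset ht hNt (Finset.mem_range.1 hi))
  have hdisj : (↑(Finset.range N) : Set ℕ).PairwiseDisjoint S := fun i _ j _ hij =>
    Disjoint.set_prod_right (disjoint_subintervals ht hij) _ _
  have hcell : ∀ i ∈ Finset.range N, Kstar0 W a (A 2) * ENNReal.ofReal t ≤
      Filter.liminf (fun n => F0 W (ε n) (un n) (bn n) (S i)) atTop := by
    intro i hi
    have hpre := preimage_affine_square hr (αi, c + (i + 1 / 2) * t)
    rw [hst] at hpre
    have hcell := Kstar0_mul_le_liminf_F0 W a (A 2) hr (αi, c + (i + 1 / 2) * t) c₀ hpre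
      (u := u) (b := b) ?_ hε hε0 (fun n => (hun n).mono (hSU i hi))
      (fun n => (hbn n).mono (hSU i hi)) ?_
    · rwa [hst] at hcell
    · rw [ae_restrict_iff' (hSm i)]
      filter_upwards [hub, ae_fst_ne αi] with z hz hne hzm
      have hzU := hSU i hi hzm
      refine ⟨?_, ?_⟩
      · rw [hc₀ z hzU hne, smul_inv_abs_smul hs ht]
      · rw [bb0_inv_mul hs ht (sub_ne_zero.2 hne)]
        rcases lt_or_gt_of_ne hne with h | h
        · rw [if_neg (by linarith), ((hz hzU).2 h).2.2]
        · rw [if_pos (by linarith), ((hz hzU).1 h).2.2]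
    · exact tendsto_of_tendsto_of_tendsto_of_le_of_le tendsto_const_nhds hconv
        (fun _ => bot_le) (fun n => lintegral_mono_set (hSU i hi))
  calc Kstar0 W a (A 2) * volume (Set.Ioo c d)
      = ∑ _i ∈ Finset.range N, Kstar0 W a (A 2) * ENNReal.ofReal t := by
        rw [Finset.sum_const, Finset.card_range, nsmul_eq_mul, Real.volume_Ioo, ← hNt,
          ENNReal.ofReal_mul hN0.le, ENNReal.ofReal_natCast]
        ring
    _ ≤ ∑ i ∈ Finset.range N,
          Filter.liminf (fun n => F0 W (ε n) (un n) (bn n) (S i)) atTop :=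
        Finset.sum_le_sum hcell
    _ ≤ Filter.liminf (fun n => ∑ i ∈ Finset.range N, F0 W (ε n) (un n) (bn n) (S i)) atTop :=
        sum_liminf_le_liminf_sum _ _
    _ ≤ _ := by
        refine liminf_le_liminf (Eventually.of_forall fun n => ?_)
        simp only [F0]
        rw [← lintegral_biUnion_finset hdisj fun i _ => hSm i]
        exact lintegral_mono_set (iUnion₂_subset hSU)
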